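/- Let q ≥ 2, N ≥ 4, r = e^{-1/N}, and z = r e^{2πiα}. Then ∑_{m+m' ≡ 0 (mod q)} Λ(m)Λ(m') z^{m+m'} = (1/φ(q)) ∑_{χ mod q} χ(-1) Ψ(z,χ)Ψ(z,χ̄) + O((log N log q)²), where the sum on the left is over all pairs of positive integers m, m' with q | (m+m'), Ψ(z,χ) = ∑_n χ(n)Λ(n)z^n, and the implied constant is absolute. -/

import Mathlib

open scoped ArithmeticFunction

/-- `Ψ(z,χ) = ∑_{n≥1} χ(n) Λ(n) zⁿ`. -/
noncomputable def PsiChi {q : ℕ} (z : ℂ) (χ : DirichletCharacter ℂ q) : ℂ :=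
  ∑' n : ℕ, χ n * (Λ n : ℂ) * z ^ n

open Finset in
/-- The lacunary sum `∑ e^{-2^k/N}` over `k ≥ 1` is `O(log N)`. -/
lemma sum_range_exp_neg_two_pow_div_le {N : ℕ} (hN : 4 ≤ N) (M : ℕ) :
    ∑ k ∈ range M, Real.exp (-1 / N) ^ 2 ^ (k + 1) ≤ 4 * Real.log N := by
  set K := Nat.log 2 N
  have hN0 : (0 : ℝ) < N := by positivity
  have hr1 : Real.exp (-1 / N) ≤ 1 := Real.exp_le_one_iff.2 (by rw [neg_div]; simp)
  have tail (j : ℕ) : Real.exp (-1 / N) ^ 2 ^ (K + j + 1) ≤ (1 / 2 : ℝ) ^ j := by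
    have hlt : (N : ℝ) ≤ 2 ^ (K + 1) := by
      exact_mod_cast (Nat.lt_pow_succ_log_self one_lt_two N).le
    have h1 : (2 : ℝ) ^ j ≤ 2 ^ (K + j + 1) / N := by
      rw [le_div_iff₀ hN0, show K + j + 1 = j + (K + 1) by ring, pow_add _ j]
      gcongr
    have h2 : (2 : ℝ) ^ j ≤ Real.exp (2 ^ (K + j + 1) / N) := by
      linarith [Real.add_one_le_exp ((2 : ℝ) ^ (K + j + 1) / N)]
    rw [← Real.exp_nat_mul, one_div, inv_pow,
      show ((2 ^ (K + j + 1) : ℕ) : ℝ) * (-1 / N) = -(2 ^ (K + j + 1) / N) by push_cast; ring,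
      Real.exp_neg]
    gcongr
  have hK : K * Real.log 2 ≤ Real.log N := by
    rw [← Real.log_pow]
    apply Real.log_le_log (by positivity)
    exact_mod_cast Nat.pow_log_le_self 2 (by omega)
  have hlog : 2 * Real.log 2 ≤ Real.log N := by
    rw [show (2 : ℝ) * Real.log 2 = Real.log 4 by
      rw [show (4 : ℝ) = 2 ^ 2 by norm_num, Real.log_pow]; norm_num]
    exact Real.log_le_log (by norm_num) (by exact_mod_cast hN)
  calc ∑ k ∈ range M, Real.exp (-1 / N) ^ 2 ^ (k + 1)
      ≤ ∑ k ∈ range (K + M), Real.exp (-1 / N) ^ 2 ^ (k + 1) :=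
        sum_le_sum_of_subset_of_nonneg (range_mono (by omega)) fun _ _ _ ↦ by positivity
    _ = ∑ k ∈ range K, Real.exp (-1 / N) ^ 2 ^ (k + 1) +
          ∑ j ∈ range M, Real.exp (-1 / N) ^ 2 ^ (K + j + 1) := sum_range_add _ _ _
    _ ≤ ∑ _k ∈ range K, 1 + ∑ j ∈ range M, (1 / 2 : ℝ) ^ j :=
        add_le_add (sum_le_sum fun _ _ ↦ pow_le_one₀ (by positivity) hr1)
          (sum_le_sum fun j _ ↦ tail j)
    _ ≤ K + 2 := by
        simpa using sum_geometric_two_le M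
    _ ≤ 4 * Real.log N := by
        nlinarith [Real.log_two_gt_d9, (Nat.cast_nonneg K : (0 : ℝ) ≤ K)]

lemma sum_primeFactors_log_le {q : ℕ} (hq : q ≠ 0) :
    ∑ p ∈ q.primeFactors, Real.log p ≤ Real.log q := by
  rw [← Real.log_prod fun p hp ↦ by exact_mod_cast (Nat.prime_of_mem_primeFactors hp).ne_zero]
  have hpos : 0 < ∏ p ∈ q.primeFactors, p :=
    Finset.prod_pos fun p hp ↦ (Nat.prime_of_mem_primeFactors hp).pos
  rw [← Nat.cast_prod]
  exact Real.log_le_log (by exact_mod_cast hpos)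
    (by exact_mod_cast Nat.le_of_dvd (Nat.pos_of_ne_zero hq) (Nat.prod_primeFactors_dvd q))

/-- A term of `∑ Λ(m) r^m` with `gcd(m,q) > 1` comes from a power of a prime divisor of `q`. -/
lemma ite_coprime_vonMangoldt_mul_pow_le {q m M : ℕ} (hq : q ≠ 0) (hm : m < M) {r : ℝ}
    (hr : 0 ≤ r) :
    (if m.Coprime q then 0 else Λ m * r ^ m) ≤
      ∑ p ∈ q.primeFactors, ∑ k ∈ Finset.range M,
        if m = p ^ (k + 1) then Real.log p * r ^ p ^ (k + 1) else 0 := by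
  have hnn (p k : ℕ) : 0 ≤ if m = p ^ (k + 1) then Real.log p * r ^ p ^ (k + 1) else 0 := by
    split_ifs
    · exact mul_nonneg (Real.log_natCast_nonneg p) (by positivity)
    · rfl
  have hsum := Finset.sum_nonneg fun p (_ : p ∈ q.primeFactors) ↦
    Finset.sum_nonneg fun k (_ : k ∈ Finset.range M) ↦ hnn p k
  split_ifs with hc
  · exact hsum
  by_cases hpp : IsPrimePow m
  · obtain ⟨p, k, hp, hk, rfl⟩ := (isPrimePow_nat_iff _).1 hpp
    obtain ⟨k, rfl⟩ := Nat.exists_eq_add_one_of_ne_zero hk.ne'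
    have hpq : p ∈ q.primeFactors := by
      refine Nat.mem_primeFactors.2 ⟨hp, ?_, hq⟩
      by_contra h
      exact hc (((Nat.Prime.coprime_iff_not_dvd hp).2 h).pow_left _)
    have hkM : k ∈ Finset.range M :=
      Finset.mem_range.2 (by have := Nat.lt_pow_self hp.one_lt (n := k + 1); omega)
    refine le_trans ?_ (Finset.single_le_sum (fun p _ ↦
      Finset.sum_nonneg fun k (_ : k ∈ Finset.range M) ↦ hnn p k) hpq)
    refine le_trans ?_ (Finset.single_le_sum (fun k _ ↦ hnn p k) hkM)
    rw [if_pos rfl, ArithmeticFunction.vonMangoldt_apply_pow k.succ_ne_zero,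
      ArithmeticFunction.vonMangoldt_apply_prime hp]
  · rwa [ArithmeticFunction.vonMangoldt_eq_zero_iff.2 hpp, zero_mul]

lemma tsum_not_coprime_vonMangoldt_le {q N : ℕ} (hq : q ≠ 0) (hN : 4 ≤ N) :
    ∑' m : ℕ, (if m.Coprime q then 0 else Λ m * Real.exp (-1 / N) ^ m) ≤
      4 * (Real.log N * Real.log q) := by
  set r := Real.exp (-1 / N)
  have hr0 : 0 ≤ r := by positivity
  have hr1 : r ≤ 1 := Real.exp_le_one_iff.2 (by rw [neg_div]; simp)
  refine Real.tsum_le_of_sum_range_le (fun m ↦ ?_) fun M ↦ ?_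
  · split_ifs
    · rfl
    · exact mul_nonneg ArithmeticFunction.vonMangoldt_nonneg (by positivity)
  calc _ ≤ ∑ m ∈ Finset.range M, ∑ p ∈ q.primeFactors, ∑ k ∈ Finset.range M,
        (if m = p ^ (k + 1) then Real.log p * r ^ p ^ (k + 1) else 0) :=
        Finset.sum_le_sum fun m hm ↦
          ite_coprime_vonMangoldt_mul_pow_le hq (Finset.mem_range.1 hm) hr0
    _ = ∑ p ∈ q.primeFactors, ∑ k ∈ Finset.range M, ∑ m ∈ Finset.range M,
        (if m = p ^ (k + 1) then Real.log p * r ^ p ^ (k + 1) else 0) := by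
        rw [Finset.sum_comm]
        exact Finset.sum_congr rfl fun p _ ↦ Finset.sum_comm
    _ ≤ ∑ p ∈ q.primeFactors, ∑ k ∈ Finset.range M, Real.log p * r ^ 2 ^ (k + 1) := by
        refine Finset.sum_le_sum fun p hp ↦ Finset.sum_le_sum fun k _ ↦ ?_
        have hlog := Real.log_natCast_nonneg p
        have hp2 := (Nat.prime_of_mem_primeFactors hp).two_le
        rw [Finset.sum_ite_eq']
        split_ifs
        · exact mul_le_mul_of_nonneg_left
            (pow_le_pow_of_le_one hr0 hr1 (Nat.pow_le_pow_left hp2 _)) hlog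
        · positivity
    _ = (∑ p ∈ q.primeFactors, Real.log p) * ∑ k ∈ Finset.range M, r ^ 2 ^ (k + 1) := by
        rw [Finset.sum_mul_sum]
    _ ≤ Real.log q * (4 * Real.log N) :=
        mul_le_mul (sum_primeFactors_log_le hq) (sum_range_exp_neg_two_pow_div_le hN M)
          (Finset.sum_nonneg fun _ _ ↦ by positivity) (Real.log_natCast_nonneg q)
    _ = _ := by ring

lemma summable_vonMangoldt_mul_pow {r : ℝ} (hr0 : 0 ≤ r) (hr1 : r < 1) :
    Summable fun m : ℕ ↦ Λ m * r ^ m := by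
  have h := summable_pow_mul_geometric_of_norm_lt_one (R := ℝ) 1
    (r := r) (by rwa [Real.norm_of_nonneg hr0])
  refine h.of_nonneg_of_le
    (fun m ↦ mul_nonneg ArithmeticFunction.vonMangoldt_nonneg (by positivity)) fun m ↦ ?_
  rw [pow_one]
  gcongr
  exact ArithmeticFunction.vonMangoldt_le_log.trans (Real.log_le_self m.cast_nonneg)

/-- Orthogonality of Dirichlet characters, detecting `m + m' ≡ 0 (mod q)` with `gcd(m,q) = 1`. -/
lemma sum_character_neg_one_mul_mul_conj {q : ℕ} [NeZero q] (m n : ℕ) :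
    ∑ χ : DirichletCharacter ℂ q, χ (-1) * χ m * (starRingEnd ℂ) (χ n) =
      if q ∣ m + n ∧ m.Coprime q then (q.totient : ℂ) else 0 := by
  by_cases hm : m.Coprime q
  swap
  · rw [if_neg fun h ↦ hm h.2]
    refine Finset.sum_eq_zero fun χ _ ↦ ?_
    rw [χ.map_nonunit fun h ↦ hm ((ZMod.isUnit_iff_coprime m q).1 h)]
    simp
  have hdvd : q ∣ m + n ↔ (n : ZMod q) = -m := by
    rw [← ZMod.natCast_eq_zero_iff, Nat.cast_add, add_comm, add_eq_zero_iff_eq_neg]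
  by_cases hn : IsUnit (n : ZMod q)
  · have h := DirichletCharacter.sum_char_inv_mul_char_eq ℂ hn (-m : ZMod q)
    rw [if_congr ((and_iff_left hm).trans hdvd) rfl rfl, ← h]
    refine Finset.sum_congr rfl fun χ _ ↦ ?_
    obtain ⟨u, hu⟩ := hn
    rw [starRingEnd_apply, MulChar.star_apply', MulChar.inv_apply, ← hu, Ring.inverse_unit,
      ZMod.inv_coe_unit, ← map_mul, neg_one_mul, mul_comm]
  · rw [if_neg]
    · refine Finset.sum_eq_zero fun χ _ ↦ ?_
      rw [χ.map_nonunit hn]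
      simp
    · rintro ⟨h, -⟩
      rw [hdvd] at h
      exact hn (h ▸ ((ZMod.isUnit_iff_coprime m q).2 hm).neg)

/-- The character sum is exactly the part of the binary sum with `gcd(m,q) = 1`. -/
lemma character_sum_eq_tsum_coprime {q : ℕ} [NeZero q] {z : ℂ} (hz : ‖z‖ < 1) :
    (1 / (q.totient : ℂ)) * ∑ χ : DirichletCharacter ℂ q, χ (-1) * PsiChi z χ *
        (∑' n : ℕ, (starRingEnd ℂ) (χ n) * (Λ n : ℂ) * z ^ n) =
      ∑' p : ℕ × ℕ, if q ∣ p.1 + p.2 ∧ p.1.Coprime q then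
        (Λ p.1 : ℂ) * (Λ p.2 : ℂ) * z ^ (p.1 + p.2) else 0 := by
  have hA := summable_vonMangoldt_mul_pow (norm_nonneg z) hz
  have hbound {c : ℂ} (hc : ‖c‖ ≤ 1) (n : ℕ) : ‖c * (Λ n : ℂ) * z ^ n‖ ≤ Λ n * ‖z‖ ^ n := by
    have h0 : 0 ≤ Λ n := ArithmeticFunction.vonMangoldt_nonneg
    rw [norm_mul, norm_mul, norm_pow, Complex.norm_real, Real.norm_of_nonneg h0]
    gcongr
    exact mul_le_of_le_one_left h0 hc
  have hs1 (χ : DirichletCharacter ℂ q) : Summable fun n : ℕ ↦ ‖χ n * (Λ n : ℂ) * z ^ n‖ :=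
    hA.of_nonneg_of_le (fun _ ↦ norm_nonneg _) fun n ↦ hbound (χ.norm_le_one _) n
  have hs2 (χ : DirichletCharacter ℂ q) :
      Summable fun n : ℕ ↦ ‖(starRingEnd ℂ) (χ n) * (Λ n : ℂ) * z ^ n‖ :=
    hA.of_nonneg_of_le (fun _ ↦ norm_nonneg _) fun n ↦
      hbound (by rw [RCLike.norm_conj]; exact χ.norm_le_one _) n
  have hterm (χ : DirichletCharacter ℂ q) := summable_mul_of_summable_norm (hs1 χ) (hs2 χ)
  have hφ : (q.totient : ℂ) ≠ 0 := by
    exact_mod_cast (Nat.totient_pos.2 (NeZero.pos q)).ne'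
  simp_rw [PsiChi, mul_assoc (_ : ℂ) (tsum _), tsum_mul_tsum_of_summable_norm (hs1 _) (hs2 _),
    ← tsum_mul_left]
  rw [← Summable.tsum_finsetSum fun χ _ ↦ (hterm χ).mul_left _, ← tsum_mul_left]
  refine tsum_congr fun p ↦ ?_
  calc _ = (1 / (q.totient : ℂ)) * ((∑ χ : DirichletCharacter ℂ q,
        χ (-1) * χ p.1 * (starRingEnd ℂ) (χ p.2)) *
          ((Λ p.1 : ℂ) * (Λ p.2 : ℂ) * z ^ (p.1 + p.2))) := by
        rw [Finset.sum_mul]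
        congr 1
        exact Finset.sum_congr rfl fun χ _ ↦ by ring
    _ = _ := by
        rw [sum_character_neg_one_mul_mul_conj]
        split_ifs
        · field_simp
        · simp

lemma norm_tsum_sub_tsum_coprime_le {q : ℕ} {z : ℂ} (hz : ‖z‖ < 1) :
    ‖(∑' p : ℕ × ℕ, if 0 < p.1 ∧ 0 < p.2 ∧ q ∣ p.1 + p.2 then
          (Λ p.1 : ℂ) * (Λ p.2 : ℂ) * z ^ (p.1 + p.2) else 0) -
        ∑' p : ℕ × ℕ, (if q ∣ p.1 + p.2 ∧ p.1.Coprime q then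
          (Λ p.1 : ℂ) * (Λ p.2 : ℂ) * z ^ (p.1 + p.2) else 0)‖ ≤
      (∑' m : ℕ, if m.Coprime q then 0 else Λ m * ‖z‖ ^ m) ^ 2 := by
  have hΛ (n : ℕ) : 0 ≤ Λ n := ArithmeticFunction.vonMangoldt_nonneg
  have hA := summable_vonMangoldt_mul_pow (norm_nonneg z) hz
  have hAnn (n : ℕ) : 0 ≤ Λ n * ‖z‖ ^ n := mul_nonneg (hΛ n) (by positivity)
  have hAA := hA.mul_of_nonneg hA hAnn hAnn
  have hnorm (p : ℕ × ℕ) : ‖(Λ p.1 : ℂ) * (Λ p.2 : ℂ) * z ^ (p.1 + p.2)‖ =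
      Λ p.1 * ‖z‖ ^ p.1 * (Λ p.2 * ‖z‖ ^ p.2) := by
    simp only [norm_mul, norm_pow, Complex.norm_real, Real.norm_of_nonneg (hΛ _)]
    ring
  have hsum (P : ℕ × ℕ → Prop) [DecidablePred P] : Summable fun p : ℕ × ℕ ↦
      if P p then (Λ p.1 : ℂ) * (Λ p.2 : ℂ) * z ^ (p.1 + p.2) else 0 := by
    refine Summable.of_norm_bounded hAA fun p ↦ ?_
    split_ifs
    · exact (hnorm p).le
    · simpa using mul_nonneg (hAnn p.1) (hAnn p.2)
  set B : ℕ → ℝ := fun m ↦ if m.Coprime q then 0 else Λ m * ‖z‖ ^ m with hB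
  have hBnn (m : ℕ) : 0 ≤ B m := by
    simp only [hB]
    split_ifs
    exacts [le_rfl, hAnn m]
  have hBs : Summable B := hA.of_nonneg_of_le hBnn fun m ↦ by
    simp only [hB]
    split_ifs
    exacts [hAnn m, le_rfl]
  have hBB := hBs.mul_of_nonneg hBs hBnn hBnn
  rw [← (hsum _).tsum_sub (hsum _), sq, hBs.tsum_mul_tsum hBs hBB]
  refine tsum_of_norm_bounded hBB.hasSum fun p ↦ ?_
  by_cases h0 : 0 < p.1 ∧ 0 < p.2
  swap
  · have : (Λ p.1 : ℂ) * (Λ p.2 : ℂ) = 0 := by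
      rcases not_and_or.1 h0 with h | h <;> simp [Nat.eq_zero_of_not_pos h]
    simpa [this] using mul_nonneg (hBnn p.1) (hBnn p.2)
  by_cases hq : q ∣ p.1 + p.2
  swap
  · simpa [hq] using mul_nonneg (hBnn p.1) (hBnn p.2)
  by_cases hc : p.1.Coprime q
  · rw [if_pos ⟨h0.1, h0.2, hq⟩, if_pos ⟨hq, hc⟩, sub_self, norm_zero]
    exact mul_nonneg (hBnn p.1) (hBnn p.2)
  have hc2 : ¬ p.2.Coprime q := by
    intro h
    obtain ⟨d, hd, hd1, hdq⟩ := Nat.Prime.not_coprime_iff_dvd.1 hc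
    exact Nat.Prime.not_coprime_iff_dvd.2
      ⟨d, hd, (Nat.dvd_add_right hd1).1 (hdq.trans hq), hdq⟩ h
  rw [if_pos ⟨h0.1, h0.2, hq⟩, if_neg fun h ↦ hc h.2, sub_zero, hnorm]
  simp [hB, hc, hc2]

/-- For `q ≥ 2`, `N ≥ 4`, `z = e^{-1/N} e^{2πiα}`:
`∑_{q | m+m'} Λ(m)Λ(m') z^{m+m'} = (1/φ(q)) ∑_χ χ(-1) Ψ(z,χ)Ψ(z,χ̄)
+ O((log N log q)²)` with an absolute implied constant. -/
theorem character_decomposition_with_error :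
    ∃ C : ℝ, 0 < C ∧ ∀ (q N : ℕ) [NeZero q], ∀ α : ℝ, 2 ≤ q → 4 ≤ N →
      ‖(∑' p : ℕ × ℕ,
          (if 0 < p.1 ∧ 0 < p.2 ∧ q ∣ (p.1 + p.2) then
            ((Λ p.1 : ℂ) * (Λ p.2 : ℂ)) *
              (((Real.exp (-1 / N) : ℝ) : ℂ) *
                Complex.exp (2 * Real.pi * Complex.I * α)) ^ (p.1 + p.2)
          else 0))
        - (1 / (Nat.totient q : ℂ)) *
            ∑ χ : DirichletCharacter ℂ q, χ (-1) *
              PsiChi (((Real.exp (-1 / N) : ℝ) : ℂ) *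
                Complex.exp (2 * Real.pi * Complex.I * α)) χ *
              (∑' n : ℕ, (starRingEnd ℂ) (χ n) * (Λ n : ℂ) *
                (((Real.exp (-1 / N) : ℝ) : ℂ) *
                  Complex.exp (2 * Real.pi * Complex.I * α)) ^ n)‖
        ≤ C * (Real.log N * Real.log q) ^ 2 := by
  refine ⟨16, by norm_num, fun q N _ α hq hN ↦ ?_⟩
  have hnorm : ‖((Real.exp (-1 / N) : ℝ) : ℂ) * Complex.exp (2 * Real.pi * Complex.I * α)‖ =
      Real.exp (-1 / N) := by
    rw [norm_mul, Complex.norm_real, Real.norm_of_nonneg (by positivity),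
      show (2 * Real.pi * Complex.I * α : ℂ) = ((2 * Real.pi * α : ℝ) : ℂ) * Complex.I by
        push_cast; ring, Complex.norm_exp_ofReal_mul_I, mul_one]
  have hlt : Real.exp (-1 / N) < 1 := by
    have : (0 : ℝ) < N := by positivity
    rw [Real.exp_lt_one_iff, neg_div]
    exact neg_neg_of_pos (by positivity)
  rw [character_sum_eq_tsum_coprime (hnorm.trans_lt hlt)]
  refine (norm_tsum_sub_tsum_coprime_le (hnorm.trans_lt hlt)).trans ?_
  rw [hnorm]
  have hnn : 0 ≤ ∑' m : ℕ, (if m.Coprime q then 0 else Λ m * Real.exp (-1 / N) ^ m) :=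
    tsum_nonneg fun m ↦ by
      split_ifs
      exacts [le_rfl, mul_nonneg ArithmeticFunction.vonMangoldt_nonneg (by positivity)]
  refine (pow_le_pow_left₀ hnn (tsum_not_coprime_vonMangoldt_le (NeZero.ne q) hN) 2).trans ?_
  exact le_of_eq (by ring)
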